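/- arXiv:1802.06103 — 7 statements merged into one kernel-verified Lean document; each statement's English description precedes it below -/
import Mathlib

section
/- Let p be a prime, λℓ, λr ∈ Z_p nonzero, and let k be an integer with 1 ≤ k ≤ p. For the bipartite graph B(k,p), the set I_LR(B(k,p)) equals { {u_i, v_i} : 1 ≤ i ≤ k }, and consequently Σ_{I ∈ I_LR(B(k,p))} λℓ^{|V_L ∩ I|} · λr^{|V_R ∩ I|} = k·λℓ·λr in Z_p. -/
attribute [local instance] Classical.propDecidable

/-- The collection of independent sets of `G`, as finsets of vertices. -/
noncomputable def indepSets {V : Type*} [Fintype V] (G : SimpleGraph V) :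
    Finset (Finset V) :=
  Finset.univ.powerset.filter fun I => ∀ u ∈ I, ∀ v ∈ I, ¬ G.Adj u v

/-- The independent sets of `G` meeting both `V_L` and `V_R`. -/
noncomputable def indepSetsLR {V : Type*} [Fintype V] (G : SimpleGraph V)
    (L R : Finset V) : Finset (Finset V) :=
  (indepSets G).filter fun I => (L ∩ I).Nonempty ∧ (R ∩ I).Nonempty

/-- The bipartite graph `B(k,p)`: the complete bipartite graph
`K_{2(p-1),2(p-1)}` on `u`'s (left summands) and `v`'s (right summands) with the
edges `(u_i, v_i)` for (0-indexed) `i < k` removed. -/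
def Bgraph (p k : ℕ) : SimpleGraph (Fin (2 * (p - 1)) ⊕ Fin (2 * (p - 1))) :=
  SimpleGraph.fromRel fun a b =>
    ∃ i j, a = Sum.inl i ∧ b = Sum.inr j ∧ ¬(i = j ∧ (i : ℕ) < k)

theorem stmt2 {p : ℕ} (hp : p.Prime) (ll lr : ZMod p)
    (hll : ll ≠ 0) (hlr : lr ≠ 0) (k : ℕ) (hk1 : 1 ≤ k) (hkp : k ≤ p)
    (L R : Finset (Fin (2 * (p - 1)) ⊕ Fin (2 * (p - 1))))
    (hL : L = Finset.univ.image Sum.inl) (hR : R = Finset.univ.image Sum.inr) :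
    indepSetsLR (Bgraph p k) L R
      = (Finset.univ.filter fun i : Fin (2 * (p - 1)) => (i : ℕ) < k).image
          (fun i => ({Sum.inl i, Sum.inr i} : Finset _))
    ∧ ∑ I ∈ indepSetsLR (Bgraph p k) L R, ll ^ (L ∩ I).card * lr ^ (R ∩ I).card
      = (k : ZMod p) * ll * lr := by
  have key : indepSetsLR (Bgraph p k) L R
      = (Finset.univ.filter fun i : Fin (2 * (p - 1)) => (i : ℕ) < k).image
          (fun i => ({Sum.inl i, Sum.inr i} : Finset _)) := by
    subst hL hR
    ext I
    simp only [indepSetsLR, indepSets, Finset.mem_filter, Finset.mem_image, Finset.mem_powerset,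
      Finset.mem_univ, true_and, Finset.subset_univ, Finset.Nonempty, Finset.mem_inter]
    constructor
    · rintro ⟨h, ⟨_, ⟨i, rfl⟩, hi⟩, ⟨_, ⟨j, rfl⟩, hj⟩⟩
      have H : ∀ a b, Sum.inl a ∈ I → Sum.inr b ∈ I → a = b ∧ (a : ℕ) < k := by
        intro a b ha hb
        by_contra hc
        refine h _ ha _ hb ?_
        rw [Bgraph, SimpleGraph.fromRel_adj]
        exact ⟨by simp, Or.inl ⟨a, b, rfl, rfl, hc⟩⟩
      obtain ⟨hij, hik⟩ := H i j hi hj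
      subst hij
      refine ⟨i, hik, ?_⟩
      ext x
      simp only [Finset.mem_insert, Finset.mem_singleton]
      constructor
      · rintro (rfl | rfl) <;> assumption
      · intro hx
        rcases x with a | b
        · left; rw [(H a i hx hj).1]
        · right; rw [(H i b hi hx).1]
    · rintro ⟨i, hik, rfl⟩
      refine ⟨?_, ⟨Sum.inl i, ⟨i, rfl⟩, by simp⟩, ⟨Sum.inr i, ⟨i, rfl⟩, by simp⟩⟩
      intro u hu v hv hadj
      rw [Bgraph, SimpleGraph.fromRel_adj] at hadj
      simp only [Finset.mem_insert, Finset.mem_singleton] at hu hv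
      rcases hadj with ⟨-, ⟨a, b, rfl, rfl, hc⟩ | ⟨a, b, rfl, rfl, hc⟩⟩ <;>
        simp at hu hv <;> subst hu <;> subst hv <;> exact hc ⟨rfl, hik⟩
  refine ⟨key, ?_⟩
  rw [key, Finset.sum_image]
  · have hc : ∀ i ∈ (Finset.univ.filter fun i : Fin (2 * (p - 1)) => (i : ℕ) < k),
        ll ^ (L ∩ ({Sum.inl i, Sum.inr i} : Finset _)).card
          * lr ^ (R ∩ ({Sum.inl i, Sum.inr i} : Finset _)).card = ll * lr := by
      intro i _
      have h1 : L ∩ ({Sum.inl i, Sum.inr i} : Finset _) = {Sum.inl i} := by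
        subst hL
        ext x
        rcases x with a | b <;> simp
      have h2 : R ∩ ({Sum.inl i, Sum.inr i} : Finset _) = {Sum.inr i} := by
        subst hR
        ext x
        rcases x with a | b <;> simp
      rw [h1, h2]; simp
    rw [Finset.sum_congr rfl hc, Finset.sum_const, nsmul_eq_mul, mul_assoc]
    have hcard : (Finset.univ.filter fun i : Fin (2 * (p - 1)) => (i : ℕ) < k).card = k := by
      have := hp.two_le
      have h := Fin.card_filter_val_lt (n := 2 * (p - 1)) (m := k)
      rw [min_eq_right (by omega)] at h
      convert h
    rw [hcard]
  · intro i _ j _ hij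
    have : Sum.inl i ∈ ({Sum.inl j, Sum.inr j} : Finset (Fin (2 * (p - 1)) ⊕ Fin (2 * (p - 1)))) := by
      have hij' : ({Sum.inl i, Sum.inr i} : Finset (Fin (2 * (p - 1)) ⊕ Fin (2 * (p - 1)))) = {Sum.inl j, Sum.inr j} := hij
      rw [← hij']; simp
    simpa using this
end

section
/- Let p be a prime and let λℓ, λr ∈ Z_p both be nonzero. Then there exist a finite bipartite graph B=(V_L,V_R,E) and distinguished vertices u_L ∈ V_L and v_R ∈ V_R such that: (1) Z_{λℓ,λr}(B) = 0 in Z_p; (2) Z_{λℓ,λr}(B − u_L) ≠ 0 in Z_p; and (3) Z_{λℓ,λr}(B − v_R) ≠ 0 in Z_p, where B − w denotes the induced bipartite subgraph of B obtained by deleting the vertex w (with the bipartition inherited from B). -/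
attribute [local instance] Classical.propDecidable

/-- The independent sets of `G` that only use vertices from the allowed set `A`
(equivalently, the independent sets of the induced subgraph of `G` on `A`). -/
noncomputable def indepSetsOn {V : Type*} [Fintype V] (G : SimpleGraph V)
    (A : Finset V) : Finset (Finset V) :=
  A.powerset.filter fun I => ∀ u ∈ I, ∀ v ∈ I, ¬ G.Adj u v

/-- The weighted independent-set partition function of the induced subgraph of
`G` on the allowed vertex set `A`, with left part `L` and right part `R`:
`Σ_{I ∈ I(G[A])} λℓ^{|V_L ∩ I|} · λr^{|V_R ∩ I|}` in `ZMod p`. -/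
noncomputable def ZwOn {p : ℕ} {V : Type*} [Fintype V] (G : SimpleGraph V)
    (L R A : Finset V) (ll lr : ZMod p) : ZMod p :=
  ∑ I ∈ indepSetsOn G A, ll ^ (L ∩ I).card * lr ^ (R ∩ I).card

def JInd {V : Type} (G : SimpleGraph V) (I : Finset V) : Prop :=
  ∀ u ∈ I, ∀ v ∈ I, ¬ G.Adj u v

noncomputable def FF {K V : Type} [Field K] [Fintype V] (G : SimpleGraph V) (w : V → K)
    (P : Finset V → Prop) : K :=
  ∑ I : Finset V, if JInd G I ∧ P I then ∏ v ∈ I, w v else 0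

def joinG {V W : Type} (G : SimpleGraph V) (H : SimpleGraph W) (r : V) (q : W) :
    SimpleGraph (V ⊕ W) where
  Adj x y := match x, y with
    | Sum.inl x, Sum.inl y => G.Adj x y
    | Sum.inr x, Sum.inr y => H.Adj x y
    | Sum.inl x, Sum.inr y => x = r ∧ y = q
    | Sum.inr y, Sum.inl x => x = r ∧ y = q
  symm := ⟨by
    rintro (x | x) (y | y) h
    · exact G.adj_symm h
    · exact h
    · exact h
    · exact H.adj_symm h⟩
  loopless := ⟨by
    rintro (x | x) h
    · exact G.irrefl h
    · exact H.irrefl h⟩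

theorem JInd_join {V W : Type} (G : SimpleGraph V) (H : SimpleGraph W) (r : V) (q : W)
    (I : Finset V) (J : Finset W) :
    JInd (joinG G H r q) (I.disjSum J) ↔ JInd G I ∧ JInd H J ∧ ¬ (r ∈ I ∧ q ∈ J) := by
  constructor
  · intro h
    refine ⟨fun u hu v hv => ?_, fun u hu v hv => ?_, fun ⟨hr, hq⟩ => ?_⟩
    · exact h (Sum.inl u) (by simpa using hu) (Sum.inl v) (by simpa using hv)
    · exact h (Sum.inr u) (by simpa using hu) (Sum.inr v) (by simpa using hv)
    · exact h (Sum.inl r) (by simpa using hr) (Sum.inr q) (by simpa using hq) ⟨rfl, rfl⟩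
  · rintro ⟨h1, h2, h3⟩ (u | u) hu (v | v) hv h
    · exact h1 u (by simpa using hu) v (by simpa using hv) h
    · obtain ⟨rfl, rfl⟩ := h
      exact h3 ⟨by simpa using hu, by simpa using hv⟩
    · obtain ⟨rfl, rfl⟩ := h
      exact h3 ⟨by simpa using hv, by simpa using hu⟩
    · exact h2 u (by simpa using hu) v (by simpa using hv) h

theorem sum_disjSum {K V W : Type} [Field K] [Fintype V] [Fintype W]
    (f : Finset (V ⊕ W) → K) : ∑ X, f X = ∑ I : Finset V, ∑ J : Finset W, f (I.disjSum J) := by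
  rw [← Fintype.sum_prod_type']
  exact (Equiv.sum_comp (Finset.sumEquiv (α := V) (β := W)).symm.toEquiv f).symm

theorem FF_join {K V W : Type} [Field K] [Fintype V] [Fintype W]
    (G : SimpleGraph V) (H : SimpleGraph W) (r : V) (q : W) (w : V → K) (x : W → K)
    (P : Finset (V ⊕ W) → Prop) (A : Finset V → Prop) (B : Finset W → Prop)
    (h : ∀ I J, ((¬ (r ∈ I ∧ q ∈ J)) ∧ P (I.disjSum J)) ↔ (A I ∧ B J)) :
    FF (joinG G H r q) (Sum.elim w x) P = FF G w A * FF H x B := by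
  unfold FF
  rw [sum_disjSum, Finset.sum_mul_sum]
  apply Finset.sum_congr rfl
  intro I _
  apply Finset.sum_congr rfl
  intro J _
  have := h I J
  have hj := JInd_join G H r q I J
  rw [Finset.prod_disjSum, ite_zero_mul_ite_zero]
  have key : (JInd (joinG G H r q) (I.disjSum J) ∧ P (I.disjSum J)) ↔
      ((JInd G I ∧ A I) ∧ (JInd H J ∧ B J)) := by tauto
  exact if_congr key rfl rfl

theorem FF_split {K V : Type} [Field K] [Fintype V] (G : SimpleGraph V) (w : V → K)
    (P Q : Finset V → Prop) :
    FF G w P = FF G w (fun I => P I ∧ Q I) + FF G w (fun I => P I ∧ ¬ Q I) := by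
  unfold FF
  rw [← Finset.sum_add_distrib]
  refine Finset.sum_congr rfl fun I _ => ?_
  by_cases h1 : JInd G I <;> by_cases h2 : P I <;> by_cases h3 : Q I <;> simp [h1, h2, h3]

theorem FF_true {K V : Type} [Field K] [Fintype V] (G : SimpleGraph V) (w : V → K) (r : V) :
    FF G w (fun _ => True) = FF G w (fun I => r ∈ I) + FF G w (fun I => r ∉ I) := by
  rw [FF_split G w _ (fun I => r ∈ I)]
  simp

def wt {K V : Type} (a b : K) (c : V → Bool) (v : V) : K := if c v then a else b

theorem wt_elim {K V W : Type} (a b : K) (c : V → Bool) (d : W → Bool) :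
    wt a b (Sum.elim c d) = Sum.elim (wt a b c) (wt a b d) := by
  funext x; cases x <;> rfl

def Real' {K : Type} [Field K] (a b : K) (c : Bool) (s : K) : Prop :=
  s ≠ 0 ∧ ∃ (V : Type) (_ : Fintype V) (G : SimpleGraph V) (col : V → Bool) (r : V),
    (∀ u v, G.Adj u v → col u ≠ col v) ∧ col r = c ∧
    FF G (wt a b col) (fun I => r ∉ I) ≠ 0 ∧
    FF G (wt a b col) (fun I => r ∈ I) = s * FF G (wt a b col) (fun I => r ∉ I)

theorem real_base {K : Type} [Field K] (a b : K) (c : Bool) (h : (if c then a else b) ≠ 0) :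
    Real' a b c (if c then a else b) := by
  refine ⟨h, Unit, inferInstance, ⊥, fun _ => c, (), by simp, rfl, ?_⟩
  have hu : (Finset.univ : Finset (Finset Unit)) = {∅, {()}} := by decide
  have hne : (∅ : Finset Unit) ≠ {()} := by decide
  unfold FF
  rw [hu, Finset.sum_pair hne, Finset.sum_pair hne]
  simp [JInd, wt]

theorem join_bip {V W : Type} (G : SimpleGraph V) (H : SimpleGraph W) (r : V) (q : W)
    (c : V → Bool) (d : W → Bool) (hc : ∀ u v, G.Adj u v → c u ≠ c v)
    (hd : ∀ u v, H.Adj u v → d u ≠ d v) (h : c r ≠ d q) (u v : V ⊕ W)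
    (huv : (joinG G H r q).Adj u v) : Sum.elim c d u ≠ Sum.elim c d v := by
  rcases u with u | u <;> rcases v with v | v
  · exact hc u v huv
  · obtain ⟨rfl, rfl⟩ := huv
    exact h
  · obtain ⟨rfl, rfl⟩ := huv
    exact h.symm
  · exact hd u v huv

theorem join_out {K V W : Type} [Field K] [Fintype V] [Fintype W]
    (G : SimpleGraph V) (H : SimpleGraph W) (r : V) (q : W) (w : V → K) (x : W → K) :
    FF (joinG G H r q) (Sum.elim w x) (fun I => Sum.inl r ∉ I) =
      FF G w (fun I => r ∉ I) * FF H x (fun _ => True) := by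
  apply FF_join
  intro I J
  simp
  tauto

theorem join_out' {K V W : Type} [Field K] [Fintype V] [Fintype W]
    (G : SimpleGraph V) (H : SimpleGraph W) (r : V) (q : W) (w : V → K) (x : W → K) :
    FF (joinG G H r q) (Sum.elim w x) (fun I => Sum.inr q ∉ I) =
      FF G w (fun _ => True) * FF H x (fun I => q ∉ I) := by
  apply FF_join
  intro I J
  simp
  tauto

theorem join_in {K V W : Type} [Field K] [Fintype V] [Fintype W]
    (G : SimpleGraph V) (H : SimpleGraph W) (r : V) (q : W) (w : V → K) (x : W → K) :
    FF (joinG G H r q) (Sum.elim w x) (fun I => Sum.inl r ∈ I) =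
      FF G w (fun I => r ∈ I) * FF H x (fun I => q ∉ I) := by
  apply FF_join
  intro I J
  simp
  tauto

theorem real_step {K : Type} [Field K] (a b : K) (c : Bool) (s t : K)
    (hs : Real' a b c s) (ht : Real' a b (!c) t) (h : 1 + t ≠ 0) :
    Real' a b c (s / (1 + t)) := by
  obtain ⟨hs0, V, _, G, col, r, hG, hr, ho, hi⟩ := hs
  obtain ⟨ht0, W, _, H, dol, q, hH, hq, ho', hi'⟩ := ht
  refine ⟨div_ne_zero hs0 h, V ⊕ W, inferInstance, joinG G H r q, Sum.elim col dol, Sum.inl r,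
    join_bip G H r q col dol hG hH (by rw [hr, hq]; cases c <;> simp), hr, ?_, ?_⟩
  · rw [wt_elim, join_out, FF_true H _ q, hi']
    refine mul_ne_zero ho ?_
    rw [show ∀ z : K, t * z + z = (1 + t) * z by intro z; ring]
    exact mul_ne_zero h ho'
  · rw [wt_elim, join_out, join_in, FF_true H _ q, hi', hi]
    field_simp
    ring

theorem exists_pair {K : Type} [Field K] [Fintype K] (p : ℕ) [CharP K p]
    (hcard : Fintype.card K = p) (a b : K) (ha : a ≠ 0) (hb : b ≠ 0)
    (hab : a ≠ -1 ∨ b ≠ -1) :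
    ∃ s t, Real' a b true s ∧ Real' a b false t ∧ 1 + s + t = 0 := by
  by_contra! hno
  have hA : Real' a b true a := real_base a b true ha
  have hB : Real' a b false b := real_base a b false hb
  set S : Finset K := Finset.univ.filter (Real' a b true) with hS
  set T : Finset K := Finset.univ.filter (Real' a b false) with hT
  have mS : ∀ s, s ∈ S ↔ Real' a b true s := by simp [hS]
  have mT : ∀ s, s ∈ T ↔ Real' a b false s := by simp [hT]
  have inv : ∀ (X : Finset K) (u : K), u ≠ 0 → (∀ s ∈ X, s / u ∈ X) →
      X.image (fun s => s / u) = X := by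
    intro X u hu hX
    apply Finset.eq_of_subset_of_card_le
    · intro y hy
      obtain ⟨s, hs, rfl⟩ := Finset.mem_image.1 hy
      exact hX s hs
    · rw [Finset.card_image_of_injective _ ((fun x y h => by simpa [hu] using h : Function.Injective (fun s : K => s / u)))]
  have mulc : ∀ (X : Finset K) (u : K), u ≠ 0 → (∀ s ∈ X, s / u ∈ X) →
      ∀ s ∈ X, u * s ∈ X := by
    intro X u hu hX s hs
    rw [← inv X u hu hX] at hs
    obtain ⟨y, hy, rfl⟩ := Finset.mem_image.1 hs
    rwa [mul_div_cancel₀ _ hu]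
  have sum0 : ∀ (X : Finset K) (u : K), u ≠ 0 → u ≠ 1 → (∀ s ∈ X, s / u ∈ X) →
      ∑ s ∈ X, s = 0 := by
    intro X u hu hu1 hX
    have h1 : ∑ s ∈ X, s = (∑ s ∈ X, s) / u := by
      conv_lhs => rw [← inv X u hu hX]
      rw [Finset.sum_image (fun x _ y _ h => by simpa [hu] using h), Finset.sum_div]
    rw [eq_div_iff hu] at h1
    have h2 : (∑ s ∈ X, s) * (u - 1) = 0 := by rw [mul_sub, h1]; ring
    rcases mul_eq_zero.1 h2 with h | h
    · exact h
    · exact absurd (sub_eq_zero.1 h) hu1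
  have stS : ∀ t ∈ T, 1 + t ≠ 0 → ∀ s ∈ S, s / (1 + t) ∈ S := fun t ht h s hs =>
    (mS _).2 (real_step a b true s t ((mS _).1 hs) ((mT _).1 ht) h)
  have stT : ∀ s ∈ S, 1 + s ≠ 0 → ∀ t ∈ T, t / (1 + s) ∈ T := fun t ht h s hs =>
    (mT _).2 (real_step a b false s t ((mT _).1 hs) ((mS _).1 ht) h)
  have aS := (mS _).2 hA
  have bT := (mT _).2 hB
  have hno' : ∀ s ∈ S, ∀ t ∈ T, 1 + s + t ≠ 0 := fun s hs t ht =>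
    hno s t ((mS _).1 hs) ((mT _).1 ht)
  have iS : 1 + b ≠ 0 → ∀ s ∈ S, 1 + s ≠ 0 := by
    intro h s hs h0
    have := mulc S (1 + b) h (stS b bT h) s hs
    refine hno' _ this b bT ?_
    linear_combination (1 + b) * h0
  have iT : 1 + a ≠ 0 → ∀ s ∈ T, 1 + s ≠ 0 := by
    intro h s hs h0
    have := mulc T (1 + a) h (stT a aS h) s hs
    refine hno' a aS _ this ?_
    linear_combination (1 + a) * h0
  have ne1 : ∀ x : K, x ≠ -1 → 1 + x ≠ 0 := fun x hx h => hx (by linear_combination h)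
  have hab2 : 1 + a ≠ 0 ∧ 1 + b ≠ 0 := by
    rcases hab with h | h
    · exact ⟨ne1 a h, iT (ne1 a h) b bT⟩
    · exact ⟨iS (ne1 b h) a aS, ne1 b h⟩
  obtain ⟨ha1, hb1⟩ := hab2
  have jS := iS hb1
  have jT := iT ha1
  have sS : ∑ s ∈ S, s = 0 := sum0 S (1 + b) hb1 (by simpa using hb) (stS b bT hb1)
  have sT : ∑ s ∈ T, s = 0 := sum0 T (1 + a) ha1 (by simpa using ha) (stT a aS ha1)
  have inj : ∀ u : K, u ≠ 0 → Function.Injective (fun s : K => (1 + s) * u) := by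
    intro u hu x y h
    exact add_left_cancel (mul_right_cancel₀ hu h)
  have sub1 : S.image (fun s => (1 + s) * b) ⊆ T := by
    intro y hy
    obtain ⟨s, hs, rfl⟩ := Finset.mem_image.1 hy
    exact mulc T (1 + s) (jS s hs) (stT s hs (jS s hs)) b bT
  have sub2 : T.image (fun s => (1 + s) * a) ⊆ S := by
    intro y hy
    obtain ⟨s, hs, rfl⟩ := Finset.mem_image.1 hy
    exact mulc S (1 + s) (jT s hs) (stS s hs (jT s hs)) a aS
  have c2 := Finset.card_le_card sub2
  rw [Finset.card_image_of_injective _ (inj a ha)] at c2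
  have e1 : S.image (fun s => (1 + s) * b) = T := by
    apply Finset.eq_of_subset_of_card_le sub1
    rwa [Finset.card_image_of_injective _ (inj b hb)]
  rw [← e1, Finset.sum_image (fun x _ y _ h => inj b hb h), ← Finset.sum_mul,
    Finset.sum_add_distrib, sS] at sT
  have hc : (S.card : K) = 0 := by
    rcases mul_eq_zero.1 sT with h | h
    · simpa using h
    · exact absurd h hb
  rw [CharP.cast_eq_zero_iff K p] at hc
  have hpos : 0 < S.card := Finset.card_pos.2 ⟨a, aS⟩
  have hlt : S.card < p := by
    rw [← hcard]
    refine Finset.card_lt_univ_of_notMem (x := 0) ?_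
    intro h
    exact ((mS _).1 h).1 rfl
  exact absurd (Nat.le_of_dvd hpos hc) (not_le.2 hlt)

def pathAdj (u v : Fin 4) : Prop := u.val + 1 = v.val ∨ v.val + 1 = u.val

def pathG : SimpleGraph (Fin 4) where
  Adj := pathAdj
  symm := ⟨fun _ _ h => Or.symm h⟩
  loopless := ⟨fun u h => by unfold pathAdj at h; omega⟩

/-- Boolean membership, with the computable decidability instance. -/
def memB (k : Fin 4) (I : Finset (Fin 4)) : Bool :=
  @decide (k ∈ I) (@Finset.decidableMem _ (instDecidableEqFin 4) k I)

theorem memB_iff (k : Fin 4) (I : Finset (Fin 4)) : memB k I = true ↔ k ∈ I := by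
  unfold memB
  exact decide_eq_true_iff

def okB (I : Finset (Fin 4)) : Bool :=
  !(memB 0 I && memB 1 I) && !(memB 1 I && memB 2 I) && !(memB 2 I && memB 3 I)

theorem okB_iff (I : Finset (Fin 4)) : okB I = true ↔ JInd pathG I := by
  have e : okB I = true ↔ ¬ (0 ∈ I ∧ 1 ∈ I) ∧ ¬ (1 ∈ I ∧ 2 ∈ I) ∧ ¬ (2 ∈ I ∧ 3 ∈ I) := by
    simp only [← memB_iff, okB]
    cases memB 0 I <;> cases memB 1 I <;> cases memB 2 I <;> cases memB 3 I <;> simp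
  rw [e]
  simp only [JInd, pathG, pathAdj, Fin.forall_fin_succ]
  simp
  tauto

def pathSum (P : Finset (Fin 4) → Bool) : ℤ :=
  ∑ I : Finset (Fin 4), bif okB I && P I then (-1) ^ I.card else 0

theorem FF_path {K : Type} [Field K] (c : Fin 4 → Bool) (P : Finset (Fin 4) → Prop)
    (Q : Finset (Fin 4) → Bool) (h : ∀ I, Q I = true ↔ P I) :
    FF pathG (wt (-1 : K) (-1) c) P = (pathSum Q : ℤ) := by
  unfold FF pathSum
  rw [Int.cast_sum]
  apply Finset.sum_congr rfl
  intro I _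
  have : ∏ v ∈ I, wt (-1 : K) (-1) c v = (-1) ^ I.card := by
    rw [← Finset.prod_const]
    refine Finset.prod_congr rfl fun v _ => ?_
    simp [wt]
  rw [this, ← okB_iff, ← h]
  cases okB I <;> cases Q I <;> simp

theorem pathSum_univ : pathSum (fun _ => true) = 0 := rfl
theorem pathSum_zero : pathSum (fun I => !memB 0 I) = -1 := rfl
theorem pathSum_three : pathSum (fun I => !memB 3 I) = -1 := rfl

theorem path_works {K : Type} [Field K] (c : Fin 4 → Bool) :
    FF pathG (wt (-1 : K) (-1) c) (fun _ => True) = 0 ∧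
    FF pathG (wt (-1 : K) (-1) c) (fun I => 0 ∉ I) ≠ 0 ∧
    FF pathG (wt (-1 : K) (-1) c) (fun I => 3 ∉ I) ≠ 0 := by
  rw [FF_path c _ (fun _ => true) (by simp),
    FF_path c _ (fun I => !memB 0 I) (by simp [← memB_iff]),
    FF_path c _ (fun I => !memB 3 I) (by simp [← memB_iff]),
    pathSum_univ, pathSum_zero, pathSum_three]
  simp

theorem path_bip (u v : Fin 4) (h : pathAdj u v) :
    (u.val % 2 == 0) ≠ (v.val % 2 == 0) := by
  unfold pathAdj at h
  intro hh
  rw [Bool.eq_iff_iff, beq_iff_eq, beq_iff_eq] at hh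
  omega

/-- Existence over an arbitrary finite vertex type. -/
theorem exists_graph {K : Type} [Field K] [Fintype K] (p : ℕ) [CharP K p]
    (hcard : Fintype.card K = p) (a b : K) (ha : a ≠ 0) (hb : b ≠ 0) :
    ∃ (V : Type) (_ : Fintype V) (G : SimpleGraph V) (col : V → Bool) (r q : V),
      (∀ u v, G.Adj u v → col u ≠ col v) ∧ col r = true ∧ col q = false ∧
      FF G (wt a b col) (fun _ => True) = 0 ∧
      FF G (wt a b col) (fun I => r ∉ I) ≠ 0 ∧
      FF G (wt a b col) (fun I => q ∉ I) ≠ 0 := by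
  by_cases hab : a ≠ -1 ∨ b ≠ -1
  · obtain ⟨s, t, hs, ht, hst⟩ := exists_pair p hcard a b ha hb hab
    obtain ⟨hs0, V, _, G, col, r, hG, hr, ho, hi⟩ := hs
    obtain ⟨ht0, W, _, H, dol, q, hH, hq, ho', hi'⟩ := ht
    refine ⟨V ⊕ W, inferInstance, joinG G H r q, Sum.elim col dol, Sum.inl r, Sum.inr q,
      join_bip G H r q col dol hG hH (by simp [hr, hq]), hr, hq, ?_, ?_, ?_⟩
    · rw [FF_true _ _ (Sum.inl r), wt_elim, join_out, join_in, FF_true H _ q, hi, hi']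
      linear_combination (FF G (wt a b col) (fun I => r ∉ I) *
        FF H (wt a b dol) (fun I => q ∉ I)) * hst
    · rw [wt_elim, join_out, FF_true H _ q, hi']
      refine mul_ne_zero ho fun h => mul_ne_zero (neg_ne_zero.2 hs0) ho' ?_
      linear_combination h - FF H (wt a b dol) (fun I => q ∉ I) * hst
    · rw [wt_elim, join_out', FF_true G _ r, hi]
      refine mul_ne_zero (fun h => mul_ne_zero (neg_ne_zero.2 ht0) ho ?_) ho'
      linear_combination h - FF G (wt a b col) (fun I => r ∉ I) * hst
  · push Not at hab
    obtain ⟨rfl, rfl⟩ := hab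
    exact ⟨Fin 4, inferInstance, pathG, fun u => (u.val % 2 == 0), 0, 3, path_bip, rfl, rfl,
      path_works _⟩

theorem ZwOn_eq {p : ℕ} [Fact p.Prime] {V : Type} [Fintype V] {n : ℕ} (e : V ≃ Fin n)
    (G : SimpleGraph V) (col : V → Bool) (a b : ZMod p) (A : Finset (Fin n))
    (P : Finset V → Prop) (h : ∀ I : Finset V, P I ↔ I.map e.toEmbedding ⊆ A) :
    ZwOn (G.comap e.symm) (Finset.univ.filter fun i => col (e.symm i) = true)
      (Finset.univ.filter fun i => col (e.symm i) = false) A a b = FF G (wt a b col) P := by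
  unfold ZwOn FF indepSetsOn
  rw [← Finset.sum_filter]
  symm
  refine Finset.sum_bij (fun I _ => I.map e.toEmbedding) ?_ ?_ ?_ ?_
  · intro I hI
    simp only [Finset.mem_filter, Finset.mem_univ, true_and, Finset.mem_powerset] at hI ⊢
    refine ⟨(h I).1 hI.2, ?_⟩
    intro u hu v hv
    simp only [Finset.mem_map_equiv] at hu hv
    exact hI.1 _ hu _ hv
  · intro I _ J _ hIJ
    exact Finset.map_injective _ hIJ
  · intro X hX
    simp only [Finset.mem_filter, Finset.mem_powerset] at hX
    have hm : (X.map e.symm.toEmbedding).map e.toEmbedding = X := by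
      ext i
      simp [Finset.mem_map_equiv]
    refine ⟨X.map e.symm.toEmbedding, ?_, hm⟩
    simp only [Finset.mem_filter, Finset.mem_univ, true_and]
    refine ⟨?_, (h _).2 (by rw [hm]; exact hX.1)⟩
    intro u hu v hv
    simp only [Finset.mem_map_equiv, Equiv.symm_symm] at hu hv
    have := hX.2 _ hu _ hv
    simpa using this
  · intro I _
    have h1 : ∀ c : Bool, ((Finset.univ.filter fun i => col (e.symm i) = c) ∩
        I.map e.toEmbedding).card = (I.filter fun v => col v = c).card := by
      intro c
      rw [← Finset.card_map e.toEmbedding]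
      congr 1
      ext i
      simp only [Finset.mem_inter, Finset.mem_filter, Finset.mem_univ, true_and,
        Finset.mem_map_equiv]
      tauto
    have h2 : ∏ v ∈ I, wt a b col v = a ^ (I.filter fun v => col v = true).card *
        b ^ (I.filter fun v => col v = false).card := by
      unfold wt
      rw [Finset.prod_ite, Finset.prod_const, Finset.prod_const]
      simp
    rw [h2, ← h1, ← h1]
    congr!

theorem stmt3 {p : ℕ} (hp : p.Prime) (ll lr : ZMod p)
    (hll : ll ≠ 0) (hlr : lr ≠ 0) :
    ∃ (n : ℕ) (B : SimpleGraph (Fin n)) (L R : Finset (Fin n)) (uL vR : Fin n),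
      L ∪ R = Finset.univ ∧ Disjoint L R ∧
      (∀ u v, B.Adj u v → (u ∈ L ∧ v ∈ R) ∨ (u ∈ R ∧ v ∈ L)) ∧
      uL ∈ L ∧ vR ∈ R ∧
      ZwOn B L R Finset.univ ll lr = 0 ∧
      ZwOn B L R (Finset.univ \ {uL}) ll lr ≠ 0 ∧
      ZwOn B L R (Finset.univ \ {vR}) ll lr ≠ 0 := by
  have : Fact p.Prime := ⟨hp⟩
  obtain ⟨V, _, G, col, r, q, hG, hr, hq, h1, h2, h3⟩ :=
    exists_graph p (ZMod.card p) ll lr hll hlr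
  let e := Fintype.equivFin V
  refine ⟨Fintype.card V, G.comap e.symm, (Finset.univ.filter fun i => col (e.symm i) = true),
      (Finset.univ.filter fun i => col (e.symm i) = false), e r, e q, ?_, ?_, ?_, ?_, ?_, ?_, ?_,
      ?_⟩
  · ext i
    simp
  · rw [Finset.disjoint_left]
    intro i
    simp
  · intro u v h
    have := hG _ _ h
    simp only [Finset.mem_filter, Finset.mem_univ, true_and]
    cases h1 : col (e.symm u) <;> cases h2 : col (e.symm v) <;> simp_all
  · simpa using hr
  · simpa using hq
  · rw [ZwOn_eq e G col ll lr _ (fun _ => True) (by simp), h1]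
  · rw [ZwOn_eq e G col ll lr _ (fun I => r ∉ I)]
    · exact h2
    · intro I
      simp [Finset.subset_iff]
      grind
  · rw [ZwOn_eq e G col ll lr _ (fun I => q ∉ I)]
    · exact h3
    · intro I
      simp [Finset.subset_iff]
      grind
end

section
/- Let p be a prime, let r ≥ 1, and let (H, v̄) and (H′, v̄′) be finite simple graphs with r distinguished vertices such that neither H nor H′ has an automorphism of order p. Then (H, v̄) and (H′, v̄′) are isomorphic if and only if for every finite simple graph (G, ū) with r distinguished vertices, |Hom((G,ū),(H,v̄))| ≡ |Hom((G,ū),(H′,v̄′))| (mod p). -/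
attribute [local instance] Classical.propDecidable

/-- The number of homomorphisms from the graph `G` with distinguished vertices
`ub` to the graph `H` with distinguished vertices `vb`. -/
noncomputable def homCount {VG VH : Type*} [Fintype VG] [Fintype VH]
    (G : SimpleGraph VG) (H : SimpleGraph VH) {r : ℕ}
    (ub : Fin r → VG) (vb : Fin r → VH) : ℕ :=
  Fintype.card {f : VG → VH //
    (∀ a b, G.Adj a b → H.Adj (f a) (f b)) ∧ ∀ i, f (ub i) = vb i}

/-- `H` has an automorphism of order `p`: an automorphism `ρ ≠ id` with `ρ^p = id`. -/
def HasOrderPAut {VH : Type*} (p : ℕ) (H : SimpleGraph VH) : Prop :=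
  ∃ ρ : H ≃g H, ρ.toEquiv ≠ Equiv.refl VH ∧ ρ.toEquiv ^ p = 1

/-- Predicate: marked homomorphism. -/
def IsMHom {VG VH : Type*} (G : SimpleGraph VG) (H : SimpleGraph VH) {r : ℕ}
    (ub : Fin r → VG) (vb : Fin r → VH) (f : VG → VH) : Prop :=
  (∀ a b, G.Adj a b → H.Adj (f a) (f b)) ∧ ∀ i, f (ub i) = vb i

/-- Number of marked homomorphisms with a given kernel. -/
noncomputable def kerCount {VG VH : Type*}
    (G : SimpleGraph VG) (H : SimpleGraph VH) {r : ℕ}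
    (ub : Fin r → VG) (vb : Fin r → VH) (s : Setoid VG) : ℕ :=
  Nat.card {f : VG → VH // IsMHom G H ub vb f ∧ Setoid.ker f = s}

theorem homCount_eq {VG VH : Type*} [Fintype VG] [Fintype VH]
    (G : SimpleGraph VG) (H : SimpleGraph VH) {r : ℕ}
    (ub : Fin r → VG) (vb : Fin r → VH) :
    homCount G H ub vb = Nat.card {f : VG → VH // IsMHom G H ub vb f} := by
  unfold homCount IsMHom
  rw [Nat.card_eq_fintype_card]

theorem homCount_congr {V W VH : Type*} [Fintype V] [Fintype W] [Fintype VH]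
    (e : V ≃ W) (G : SimpleGraph V) (H : SimpleGraph VH) {r : ℕ}
    (ub : Fin r → V) (vb : Fin r → VH) :
    homCount (G.comap e.symm) H (fun i => e (ub i)) vb = homCount G H ub vb := by
  rw [homCount_eq, homCount_eq]
  refine Nat.card_congr (Equiv.subtypeEquiv (Equiv.arrowCongr e.symm (Equiv.refl _)) ?_)
  intro f
  constructor
  · rintro ⟨h1, h2⟩
    refine ⟨fun a b hab => h1 _ _ (by simpa using hab), fun i => h2 i⟩
  · rintro ⟨h1, h2⟩
    refine ⟨fun a b hab => ?_, fun i => h2 i⟩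
    have := h1 _ _ (show G.Adj (e.symm a) (e.symm b) from hab)
    simpa using this

theorem homCount_sum {VG VH : Type*} [Fintype VG] [Fintype VH] [Fintype (Setoid VG)]
    (G : SimpleGraph VG) (H : SimpleGraph VH) {r : ℕ}
    (ub : Fin r → VG) (vb : Fin r → VH) :
    homCount G H ub vb = ∑ s : Setoid VG, kerCount G H ub vb s := by
  rw [homCount_eq]
  unfold kerCount
  rw [← Nat.card_sigma]
  exact Nat.card_congr
    { toFun := fun f => ⟨Setoid.ker f.1, f.1, f.2, rfl⟩
      invFun := fun x => ⟨x.2.1, x.2.2.1⟩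
      left_inv := fun f => rfl
      right_inv := by rintro ⟨s, f, hf, rfl⟩; rfl }

/-- The quotient graph, with loops dropped. -/
def quotGraph {V : Type*} (G : SimpleGraph V) (s : Setoid V) : SimpleGraph (Quotient s) where
  Adj x y := x ≠ y ∧ ∃ a b, Quotient.mk s a = x ∧ Quotient.mk s b = y ∧ G.Adj a b
  symm := ⟨by
    rintro x y ⟨h, a, b, ha, hb, hab⟩
    exact ⟨h.symm, b, a, hb, ha, hab.symm⟩⟩
  loopless := ⟨fun x h => h.1 rfl⟩

theorem kerCount_bad {VG VH : Type*}
    (G : SimpleGraph VG) (H : SimpleGraph VH) {r : ℕ}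
    (ub : Fin r → VG) (vb : Fin r → VH) (s : Setoid VG)
    (hs : ∃ a b, G.Adj a b ∧ s a b) : kerCount G H ub vb s = 0 := by
  obtain ⟨a, b, hab, h⟩ := hs
  unfold kerCount
  have : IsEmpty {f : VG → VH // IsMHom G H ub vb f ∧ Setoid.ker f = s} := by
    refine ⟨?_⟩
    rintro ⟨f, hf, rfl⟩
    have h1 := hf.1 a b hab
    rw [show f a = f b from h] at h1
    exact H.loopless.irrefl _ h1
  exact Nat.card_of_isEmpty

theorem kerCount_good {VG VH : Type*}
    (G : SimpleGraph VG) (H : SimpleGraph VH) {r : ℕ}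
    (ub : Fin r → VG) (vb : Fin r → VH) (s : Setoid VG)
    (hs : ¬ ∃ a b, G.Adj a b ∧ s a b) :
    kerCount G H ub vb s =
      kerCount (quotGraph G s) H (fun i => Quotient.mk s (ub i)) vb ⊥ := by
  unfold kerCount
  refine Nat.card_congr
    { toFun := fun f => ⟨Quotient.lift f.1 (fun a b hab => by
          have h := f.2.2
          have h2 : Setoid.ker f.1 a b := by rw [h]; exact hab
          exact h2), ⟨?_, fun i => f.2.1.2 i⟩, ?_⟩
      invFun := fun g => ⟨fun a => g.1 (Quotient.mk s a), ⟨?_, fun i => g.2.1.2 i⟩, ?_⟩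
      left_inv := fun f => rfl
      right_inv := fun g => by
        apply Subtype.ext
        funext x
        induction x using Quotient.inductionOn
        rfl }
  · rintro x y ⟨_, a, b, rfl, rfl, hab⟩
    exact f.2.1.1 a b hab
  · ext x y
    induction x using Quotient.inductionOn with | _ a
    induction y using Quotient.inductionOn with | _ b
    have h := f.2.2
    have h2 : Setoid.ker f.1 a b ↔ Quotient.mk s a = Quotient.mk s b := by
      rw [h, Quotient.eq]
    exact h2
  · intro a b hab
    refine g.2.1.1 _ _ ⟨fun h => hs ⟨a, b, hab, Quotient.exact h⟩, a, b, rfl, rfl, hab⟩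
  · ext a b
    have h := g.2.2
    have : Setoid.ker g.1 (Quotient.mk s a) (Quotient.mk s b) ↔ s a b := by
      rw [h]
      exact Quotient.eq
    exact this

universe u v w

theorem inj_eq {p r : ℕ}
    {VH : Type u} {VH' : Type v} [Fintype VH] [Fintype VH']
    (H : SimpleGraph VH) (H' : SimpleGraph VH')
    (vb : Fin r → VH) (vb' : Fin r → VH')
    (h : ∀ (n : ℕ) (G : SimpleGraph (Fin n)) (ub : Fin r → Fin n),
        (homCount G H ub vb : ZMod p) = (homCount G H' ub vb' : ZMod p)) :
    ∀ (n : ℕ) (V : Type w) [Fintype V] (_ : Fintype.card V = n) (G : SimpleGraph V)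
      (ub : Fin r → V),
      (kerCount G H ub vb ⊥ : ZMod p) = (kerCount G H' ub vb' ⊥ : ZMod p) := by
  intro n
  induction n using Nat.strong_induction_on with
  | _ n ih =>
  intro V _ hV G ub
  have hf : Finite (Setoid V) :=
    Finite.of_injective (fun s : Setoid V => (fun a b => s a b : V → V → Prop))
      (fun s t hst => Setoid.ext fun a b => by
        have := congrFun (congrFun hst a) b
        exact iff_of_eq this)
  have : Fintype (Setoid V) := Fintype.ofFinite _
  have key := h _ (G.comap (Fintype.equivFin V).symm) (fun i => Fintype.equivFin V (ub i))
  rw [homCount_congr, homCount_congr, homCount_sum, homCount_sum] at key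
  push_cast at key
  rw [← Finset.add_sum_erase _ _ (Finset.mem_univ (⊥ : Setoid V)),
    ← Finset.add_sum_erase _ _ (Finset.mem_univ (⊥ : Setoid V))] at key
  have h2 : ∀ s ∈ (Finset.univ : Finset (Setoid V)).erase ⊥,
      (kerCount G H ub vb s : ZMod p) = (kerCount G H' ub vb' s : ZMod p) := by
    intro s hs
    have hs := Finset.ne_of_mem_erase hs
    by_cases hb : ∃ a b, G.Adj a b ∧ s a b
    · rw [kerCount_bad _ _ _ _ _ hb, kerCount_bad _ _ _ _ _ hb]
    · rw [kerCount_good _ _ _ _ _ hb, kerCount_good _ _ _ _ _ hb]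
      refine ih (Fintype.card (Quotient s)) ?_ _ rfl _ _
      rw [← hV]
      refine Fintype.card_lt_of_surjective_not_injective (Quotient.mk s)
        Quotient.mk_surjective ?_
      intro hinj
      apply hs
      ext a b
      rw [Setoid.bot_def]
      constructor
      · intro hab
        exact hinj (Quotient.sound hab)
      · rintro rfl
        exact s.refl _
  rw [Finset.sum_congr rfl h2] at key
  exact add_right_cancel key

theorem ker_bot_iff {V W : Type*} (f : V → W) : Setoid.ker f = ⊥ ↔ Function.Injective f := by
  constructor
  · intro h a b hab
    have : Setoid.ker f a b := hab
    rw [h] at this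
    exact this
  · intro h
    ext a b
    rw [Setoid.bot_def]
    exact ⟨fun hab => h hab, fun hab => congrArg f hab⟩

theorem reflect {V : Type*} [Finite V] (H : SimpleGraph V) (f : V → V)
    (hf : Function.Injective f) (hh : ∀ a b, H.Adj a b → H.Adj (f a) (f b)) (a b : V)
    (hab : H.Adj (f a) (f b)) : H.Adj a b := by
  let σ : Equiv.Perm V := Equiv.ofBijective f (Finite.injective_iff_bijective.1 hf)
  have hk : ∀ (k : ℕ) a b, H.Adj a b → H.Adj ((σ ^ k) a) ((σ ^ k) b) := by
    intro k
    induction k with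
    | zero => intro a b h; simpa using h
    | succ k ih => intro a b h; rw [pow_succ]; exact ih _ _ (hh a b h)
  have hpos : 0 < orderOf σ := orderOf_pos σ
  have h1 : ∀ c, (σ ^ (orderOf σ - 1)) (f c) = c := by
    intro c
    have : (σ ^ (orderOf σ - 1) * σ) c = c := by
      rw [← pow_succ, Nat.sub_add_cancel hpos, pow_orderOf_eq_one]; rfl
    exact this
  have := hk (orderOf σ - 1) _ _ hab
  rwa [h1, h1] at this

/-- Group of marked automorphisms. -/
def mAut {V : Type*} (H : SimpleGraph V) {r : ℕ} (vb : Fin r → V) :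
    Subgroup (Equiv.Perm V) where
  carrier := {σ | (∀ a b, H.Adj (σ a) (σ b) ↔ H.Adj a b) ∧ ∀ i, σ (vb i) = vb i}
  mul_mem' := by
    rintro σ τ ⟨h1, h2⟩ ⟨h3, h4⟩
    refine ⟨fun a b => (h1 _ _).trans (h3 _ _), fun i => ?_⟩
    rw [Equiv.Perm.mul_apply, h4, h2]
  one_mem' := ⟨fun a b => Iff.rfl, fun i => rfl⟩
  inv_mem' := by
    rintro σ ⟨h1, h2⟩
    refine ⟨fun a b => ?_, fun i => ?_⟩
    · rw [← h1]; simp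
    · rw [Equiv.Perm.inv_eq_iff_eq, h2]

theorem self_ne {p r : ℕ} (hp : p.Prime) {V : Type*} [Fintype V] (H : SimpleGraph V)
    (vb : Fin r → V) (hH : ¬ HasOrderPAut p H) : (kerCount H H vb vb ⊥ : ZMod p) ≠ 0 := by
  have hc : kerCount H H vb vb ⊥ = Nat.card (mAut H vb) := by
    unfold kerCount
    refine Nat.card_congr
      { toFun := fun f => ⟨Equiv.ofBijective f.1
          (Finite.injective_iff_bijective.1 ((ker_bot_iff _).1 f.2.2)),
          fun a b => ⟨reflect H f.1 ((ker_bot_iff _).1 f.2.2) f.2.1.1 a b, f.2.1.1 a b⟩,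
          f.2.1.2⟩
        invFun := fun σ => ⟨σ.1, ⟨fun a b => (σ.2.1 a b).2, σ.2.2⟩,
          (ker_bot_iff _).2 σ.1.injective⟩
        left_inv := fun f => rfl
        right_inv := fun σ => by
          apply Subtype.ext
          ext x
          rfl }
  rw [hc]
  intro h0
  rw [ZMod.natCast_eq_zero_iff] at h0
  have : Fact p.Prime := ⟨hp⟩
  obtain ⟨σ, hσ⟩ := exists_prime_orderOf_dvd_card' p h0
  apply hH
  refine ⟨⟨σ.1, fun {a b} => σ.2.1 a b⟩, ?_, ?_⟩
  · intro h1
    have h2 : σ = 1 := Subtype.ext h1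
    rw [h2, orderOf_one] at hσ
    exact hp.one_lt.ne hσ
  · have := pow_orderOf_eq_one σ
    rw [hσ] at this
    exact congrArg Subtype.val this

theorem exists_of_ne {p r : ℕ} {V W : Type*} (G : SimpleGraph V) (H : SimpleGraph W)
    (ub : Fin r → V) (vb : Fin r → W) (h : (kerCount G H ub vb ⊥ : ZMod p) ≠ 0) :
    ∃ f : V → W, IsMHom G H ub vb f ∧ Function.Injective f := by
  by_contra hcon
  apply h
  have : IsEmpty {f : V → W // IsMHom G H ub vb f ∧ Setoid.ker f = ⊥} :=
    ⟨fun f => hcon ⟨f.1, f.2.1, (ker_bot_iff _).1 f.2.2⟩⟩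
  unfold kerCount
  rw [Nat.card_of_isEmpty, Nat.cast_zero]

theorem stmt4 {p : ℕ} (hp : p.Prime) {r : ℕ} (hr : 1 ≤ r)
    {VH VH' : Type*} [Fintype VH] [Fintype VH']
    (H : SimpleGraph VH) (H' : SimpleGraph VH')
    (vb : Fin r → VH) (vb' : Fin r → VH')
    (hH : ¬ HasOrderPAut p H) (hH' : ¬ HasOrderPAut p H') :
    (∃ φ : H ≃g H', ∀ i, φ (vb i) = vb' i) ↔
      ∀ (n : ℕ) (G : SimpleGraph (Fin n)) (ub : Fin r → Fin n),
        (homCount G H ub vb : ZMod p) = (homCount G H' ub vb' : ZMod p) := by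
  constructor
  · rintro ⟨φ, hφ⟩ n G ub
    congr 1
    rw [homCount_eq, homCount_eq]
    refine Nat.card_congr (Equiv.subtypeEquiv (Equiv.arrowCongr (Equiv.refl _) φ.toEquiv) ?_)
    intro f
    constructor
    · rintro ⟨h1, h2⟩
      refine ⟨fun a b hab => φ.map_adj_iff.2 (h1 a b hab), fun i => ?_⟩
      change φ (f (ub i)) = _
      rw [h2, hφ]
    · rintro ⟨h1, h2⟩
      refine ⟨fun a b hab => φ.map_adj_iff.1 (h1 a b hab), fun i => ?_⟩
      have h3 : φ (f (ub i)) = _ := h2 i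
      rw [← hφ] at h3
      exact φ.injective h3
  · intro h
    have e1 := inj_eq H H' vb vb' h _ VH rfl H vb
    have e2 := inj_eq H H' vb vb' h _ VH' rfl H' vb'
    obtain ⟨f, hf, hfi⟩ := exists_of_ne H H' vb vb' (e1 ▸ self_ne hp H vb hH)
    obtain ⟨g, hg, hgi⟩ := exists_of_ne H' H vb' vb (e2.symm ▸ self_ne hp H' vb' hH')
    have hgf : Function.Injective (g ∘ f) := hgi.comp hfi
    have hsurj : Function.Surjective f := by
      intro y
      obtain ⟨x, hx⟩ := (Finite.injective_iff_surjective.1 hgf) (g y)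
      exact ⟨x, hgi hx⟩
    refine ⟨⟨Equiv.ofBijective f ⟨hfi, hsurj⟩, fun {a b} => ⟨fun hab => ?_, hf.1 a b⟩⟩, hf.2⟩
    exact reflect H (g ∘ f) hgf (fun a b hab => hg.1 _ _ (hf.1 _ _ hab)) a b (hg.1 _ _ hab)
end

section
/- Let p be a prime, μ ≥ 1 an integer, and let S ⊆ (Z_p)^μ be a set of vectors closed under componentwise addition and componentwise multiplication. If the all-ones vector 1^μ belongs to S, and for every pair of distinct indices i, j ∈ {1,...,μ} there exists a vector s ∈ S with s_i ≠ s_j, then S = (Z_p)^μ. -/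
theorem stmt6 {p : ℕ} (hp : p.Prime) {μ : ℕ} (hμ : 1 ≤ μ)
    (S : Set (Fin μ → ZMod p))
    (hadd : ∀ s ∈ S, ∀ t ∈ S, s + t ∈ S)
    (hmul : ∀ s ∈ S, ∀ t ∈ S, s * t ∈ S)
    (hone : (fun _ => 1 : Fin μ → ZMod p) ∈ S)
    (hsep : ∀ i j : Fin μ, i ≠ j → ∃ s ∈ S, s i ≠ s j) :
    S = Set.univ := by
  have : Fact p.Prime := ⟨hp⟩
  have hnat : ∀ n : ℕ, (fun _ => ((n + 1 : ℕ) : ZMod p) : Fin μ → ZMod p) ∈ S := by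
    intro n
    induction n with
    | zero => simpa using hone
    | succ k ih =>
      have h := hadd _ ih _ hone
      convert h using 1
      funext i
      simp
  have hconst : ∀ c : ZMod p, (fun _ => c : Fin μ → ZMod p) ∈ S := by
    intro c
    have h := hnat ((c - 1).val)
    have e : (((c - 1).val + 1 : ℕ) : ZMod p) = c := by
      rw [Nat.cast_add, ZMod.natCast_zmod_val]
      simp
    rwa [e] at h
  have hpair : ∀ i j : Fin μ, ∃ s ∈ S, s i = 1 ∧ (i ≠ j → s j = 0) := by
    intro i j
    by_cases hij : i = j
    · exact ⟨_, hone, rfl, fun h => absurd hij h⟩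
    · obtain ⟨s, hs, hne⟩ := hsep i j hij
      refine ⟨_, hmul _ (hadd _ hs _ (hconst (-(s j)))) _ (hconst ((s i - s j)⁻¹)), ?_, ?_⟩
      · have : s i - s j ≠ 0 := sub_ne_zero.mpr hne
        simp [← sub_eq_add_neg, this]
      · intro _
        simp
  choose e heS he1 he0 using hpair
  have hprod : ∀ (i : Fin μ) (T : Finset (Fin μ)), (∏ j ∈ T, e i j) ∈ S := by
    intro i T
    induction T using Finset.induction_on with
    | empty => rw [Finset.prod_empty]; exact hone
    | insert a T ha ih =>
      rw [Finset.prod_insert ha]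
      exact hmul _ (heS i a) _ ih
  have hsum : ∀ (v : Fin μ → ZMod p) (T : Finset (Fin μ)),
      (∑ i ∈ T, (fun _ => v i : Fin μ → ZMod p) * ∏ j, e i j) ∈ S := by
    intro v T
    induction T using Finset.induction_on with
    | empty => rw [Finset.sum_empty]; exact hconst 0
    | insert a T ha ih =>
      rw [Finset.sum_insert ha]
      exact hadd _ (hmul _ (hconst _) _ (hprod a _)) _ ih
  refine Set.eq_univ_of_forall fun v => ?_
  convert hsum v Finset.univ using 1
  funext k
  rw [Finset.sum_apply, Finset.sum_eq_single k]
  · simp [Finset.prod_apply, he1]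
  · intro i _ hik
    simp only [Pi.mul_apply, Finset.prod_apply]
    have h0 : ∏ c, e i c k = 0 := Finset.prod_eq_zero (Finset.mem_univ k) (he0 i k hik)
    rw [h0, mul_zero]
  · simp
end

section
/- Let p be a prime and let H be a finite tree that has no automorphism of order p. Then either H is a star, or H contains a path x_0 x_1 ... x_k with k ≥ 1 such that deg_H(x_0) ≢ 1 (mod p), deg_H(x_k) ≢ 1 (mod p), and deg_H(x_i) ≡ 1 (mod p) for all 0 < i < k. -/
attribute [local instance] Classical.propDecidable

/-- The degree of the vertex `v` in `H`. -/
noncomputable def deg {V : Type*} (H : SimpleGraph V) (v : V) : ℕ :=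
  Nat.card (H.neighborSet v)

/-- `H` is a star `K_{1,k}`: there is a centre adjacent to exactly the other
vertices, and there are no further edges. -/
def IsStar {V : Type*} (H : SimpleGraph V) : Prop :=
  ∃ c : V, ∀ u v, H.Adj u v ↔ (u = c ∨ v = c) ∧ u ≠ v

theorem aut_of_leaves {p : ℕ} (hp : p.Prime) {V : Type*} [Fintype V]
    (H : SimpleGraph V) (v : V) (S : Finset V) (hS : S.card = p)
    (hl : ∀ u ∈ S, ∀ w, H.Adj u w ↔ w = v) : HasOrderPAut p H := by
  obtain ⟨f, hf, hsupp⟩ := S.exists_cycleOn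
  have hfix : ∀ x, x ∉ S → f x = x := by
    intro x hx
    by_contra h
    exact hx (hsupp (Equiv.Perm.mem_support.2 h))
  have hmem : ∀ x, x ∈ S → f x ∈ S := fun x hx => hf.1.mapsTo hx
  have hv : v ∉ S := fun h => H.irrefl ((hl v h v).2 rfl)
  have hfv : f v = v := hfix v hv
  have hinj : ∀ b, f b = v ↔ b = v := by
    intro b
    constructor
    · intro h
      exact f.injective (h.trans hfv.symm)
    · rintro rfl
      exact hfv
  refine ⟨⟨f, ?_⟩, ?_, ?_⟩
  · intro a b
    by_cases ha : a ∈ S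
    · rw [hl _ (hmem a ha), hl a ha, hinj]
    · by_cases hb : b ∈ S
      · rw [H.adj_comm, H.adj_comm a b, hl _ (hmem b hb), hl b hb, hinj]
      · rw [hfix a ha, hfix b hb]
  · intro h
    have h1 : 1 < S.card := hS ▸ hp.one_lt
    obtain ⟨a, ha⟩ : S.Nonempty := Finset.card_pos.1 (by omega)
    have hne : f a ≠ a := hf.apply_ne (Finset.one_lt_card_iff_nontrivial.1 h1) ha
    exact hne (by
      have := congrArg (fun e : V ≃ V => e a) h
      simpa using this)
  · ext x
    change (f ^ p) x = x
    by_cases hx : x ∈ S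
    · rw [← hS]
      exact hf.pow_card_apply hx
    · exact Equiv.Perm.pow_apply_eq_self_of_apply_eq_self (hfix x hx) p

theorem parent_unique {V : Type*} (H : SimpleGraph V) (htree : H.IsTree) (r v w₁ w₂ : V)
    (h₁ : H.Adj w₁ v) (h₂ : H.Adj w₂ v) (d₁ : H.dist r v = H.dist r w₁ + 1)
    (d₂ : H.dist r v = H.dist r w₂ + 1) : w₁ = w₂ := by
  obtain ⟨q₁, e₁⟩ := htree.connected.exists_walk_length_eq_dist r w₁
  obtain ⟨q₂, e₂⟩ := htree.connected.exists_walk_length_eq_dist r w₂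
  have i₁ := (q₁.concat h₁).isPath_of_length_eq_dist (by rw [SimpleGraph.Walk.length_concat]; omega)
  have i₂ := (q₂.concat h₂).isPath_of_length_eq_dist (by rw [SimpleGraph.Walk.length_concat]; omega)
  have := congrArg Subtype.val (htree.isAcyclic.path_unique ⟨_, i₁⟩ ⟨_, i₂⟩)
  have := congrArg SimpleGraph.Walk.penultimate this
  simpa using this

theorem star_of_one_bad {p : ℕ} (hp : p.Prime) {V : Type*} [Fintype V]
    (H : SimpleGraph V) (htree : H.IsTree) (hH : ¬ HasOrderPAut p H) (r : V)
    (hr : ∀ v, v ≠ r → (deg H v : ZMod p) = 1) : IsStar H := by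
  haveI : Fact p.Prime := ⟨hp⟩
  have hdeg : ∀ v, deg H v = (Finset.univ.filter (fun w => H.Adj v w)).card := by
    intro v
    unfold deg
    rw [Nat.card_eq_fintype_card, Fintype.card_subtype]
    simp
  have hleaf : ∀ v, v ≠ r → deg H v = 1 := by
    by_contra hcon
    push Not at hcon
    let B : Finset V := Finset.univ.filter (fun v => v ≠ r ∧ deg H v ≠ 1)
    have hB : B.Nonempty := by
      obtain ⟨v, h1, h2⟩ := hcon
      exact ⟨v, by simp [B, h1, h2]⟩
    obtain ⟨v, hvB, hmax⟩ := B.exists_max_image (fun v => H.dist r v) hB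
    simp only [B, Finset.mem_filter, Finset.mem_univ, true_and] at hvB hmax
    obtain ⟨hvr, hv1⟩ := hvB
    let L := Finset.univ.filter (fun w => H.Adj v w ∧ deg H w = 1)
    let M := Finset.univ.filter (fun w => H.Adj v w ∧ deg H w ≠ 1)
    have hM : M.card ≤ 1 := by
      have key : ∀ w ∈ M, H.Adj v w ∧ H.dist r v = H.dist r w + 1 := by
        intro w hw
        simp only [M, Finset.mem_filter, Finset.mem_univ, true_and] at hw
        refine ⟨hw.1, ?_⟩
        rcases htree.isAcyclic.dist_eq_dist_add_one_of_adj_of_reachable r hw.1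
          (htree.connected r v) with h | h
        · exact h
        · exfalso
          have hwr : w ≠ r := by
            rintro rfl
            simp at h
          have := hmax w ⟨hwr, hw.2⟩
          omega
      rw [Finset.card_le_one]
      intro a ha b hb
      exact parent_unique H htree r v a b (key a ha).1.symm (key b hb).1.symm (key a ha).2
        (key b hb).2
    have hsum : L.card + M.card = deg H v := by
      rw [hdeg, ← Finset.card_filter_add_card_filter_not (s := Finset.univ.filter (fun w => H.Adj v w))
        (fun w => deg H w = 1), Finset.filter_filter, Finset.filter_filter]
    have hmod : deg H v ≡ 1 [MOD p] := by
      rw [← ZMod.natCast_eq_natCast_iff]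
      simpa using hr v hvr
    have h0 : deg H v ≠ 0 := by
      intro h
      have := hr v hvr
      rw [h] at this
      simp at this
    have hdvd : p ∣ deg H v - 1 := (Nat.modEq_iff_dvd' (by omega)).1 hmod.symm
    have hle : p ≤ deg H v - 1 := Nat.le_of_dvd (by omega) hdvd
    obtain ⟨S, hSL, hS⟩ := Finset.exists_subset_card_eq (s := L) (n := p) (by omega)
    refine hH (aut_of_leaves hp H v S hS ?_)
    intro u hu w
    have huL := hSL hu
    simp only [L, Finset.mem_filter, Finset.mem_univ, true_and] at huL
    have hc := huL.2
    rw [hdeg, Finset.card_eq_one] at hc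
    obtain ⟨a, ha⟩ := hc
    have hva : v = a := by
      have : v ∈ Finset.univ.filter (fun w => H.Adj u w) := by simpa using huL.1.symm
      rw [ha] at this
      simpa using this
    have := Finset.ext_iff.1 ha w
    simpa [hva] using this
  have hu1 : ∀ v a b, v ≠ r → H.Adj v a → H.Adj v b → a = b := by
    intro v a b hv ha hb
    have := hleaf v hv
    rw [hdeg] at this
    exact Finset.card_le_one.1 this.le a (by simpa using ha) b (by simpa using hb)
  have hadj : ∀ v, v ≠ r → H.Adj v r := by
    intro v hv
    obtain ⟨q, hq⟩ := htree.connected.exists_walk_length_eq_dist v r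
    have hpath := q.isPath_of_length_eq_dist hq
    cases q with
    | nil => exact absurd rfl hv
    | cons h q' =>
      cases q' with
      | nil => exact h
      | cons h' q'' =>
        rename_i w x
        exfalso
        rw [SimpleGraph.Walk.cons_isPath_iff] at hpath
        have hwr : w ≠ r := by
          rintro rfl
          have := SimpleGraph.Walk.cons_isPath_iff h' q'' |>.1 hpath.1
          exact this.2 q''.end_mem_support
        have := hu1 w v x hwr h.symm h'
        subst this
        exact hpath.2 (by simp)
  refine ⟨r, fun u v => ⟨fun h => ⟨?_, h.ne⟩, ?_⟩⟩
  · by_contra hc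
    push Not at hc
    exact hc.2 (hu1 u v r hc.1 h (hadj u hc.1))
  · rintro ⟨rfl | rfl, h⟩
    · exact (hadj v h.symm).symm
    · exact hadj u h

theorem path_of_two_bad {V : Type*} [Fintype V]
    (H : SimpleGraph V) (hconn : H.Connected) (Q : V → Prop) (a b : V) (hab : a ≠ b)
    (ha : Q a) (hb : Q b) :
    ∃ (k : ℕ) (x : Fin (k + 1) → V), 1 ≤ k ∧ Function.Injective x ∧
        (∀ i : Fin k, H.Adj (x i.castSucc) (x i.succ)) ∧
        Q (x 0) ∧ Q (x (Fin.last k)) ∧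
        ∀ i : Fin (k + 1), 0 < (i : ℕ) → (i : ℕ) < k → ¬ Q (x i) := by
  let B : Finset (V × V) := Finset.univ.filter (fun z => z.1 ≠ z.2 ∧ Q z.1 ∧ Q z.2)
  have hB : B.Nonempty := ⟨(a, b), by simp [B, hab, ha, hb]⟩
  obtain ⟨⟨u, v⟩, huv, hmin⟩ := B.exists_min_image (fun z => H.dist z.1 z.2) hB
  simp only [B, Finset.mem_filter, Finset.mem_univ, true_and] at huv hmin
  obtain ⟨hne, hu, hv⟩ := huv
  obtain ⟨q, hq⟩ := hconn.exists_walk_length_eq_dist u v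
  have hpath := q.isPath_of_length_eq_dist hq
  have hpos := hconn.pos_dist_of_ne hne
  have hinj : ∀ i j : ℕ, i ≤ q.length → j ≤ q.length → q.getVert i = q.getVert j → i = j :=
    fun i j hi hj h => hpath.getVert_injOn hi hj h
  refine ⟨q.length, fun i => q.getVert i, by omega, ?_, ?_, ?_, ?_, ?_⟩
  · intro i j h
    exact Fin.ext (hinj i j (by omega) (by omega) h)
  · intro i
    exact q.adj_getVert_succ i.2
  · simpa using hu
  · simpa using hv
  · intro i h0 hk hQ
    have h1 : u ≠ q.getVert i := by
      intro h
      have := hinj 0 i (by omega) (by omega) (by simpa using h)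
      omega
    have h2 := hmin (u, q.getVert i) ⟨h1, hu, hQ⟩
    have h3 := SimpleGraph.dist_le (q.take i)
    rw [SimpleGraph.Walk.take_length] at h3
    have h4 : (i : ℕ) ⊓ q.length ≤ i := inf_le_left
    simp only at h2
    omega

theorem stmt10 {p : ℕ} (hp : p.Prime) {V : Type*} [Fintype V]
    (H : SimpleGraph V) (htree : H.IsTree) (hH : ¬ HasOrderPAut p H) :
    IsStar H ∨
      ∃ (k : ℕ) (x : Fin (k + 1) → V), 1 ≤ k ∧ Function.Injective x ∧
        (∀ i : Fin k, H.Adj (x i.castSucc) (x i.succ)) ∧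
        (deg H (x 0) : ZMod p) ≠ 1 ∧
        (deg H (x (Fin.last k)) : ZMod p) ≠ 1 ∧
        ∀ i : Fin (k + 1), 0 < (i : ℕ) → (i : ℕ) < k →
          (deg H (x i) : ZMod p) = 1 := by
  by_cases h : ∃ a b, a ≠ b ∧ (deg H a : ZMod p) ≠ 1 ∧ (deg H b : ZMod p) ≠ 1
  · obtain ⟨a, b, hab, ha, hb⟩ := h
    right
    obtain ⟨k, x, h1, h2, h3, h4, h5, h6⟩ := path_of_two_bad H htree.connected
      (fun v => (deg H v : ZMod p) ≠ 1) a b hab ha hb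
    exact ⟨k, x, h1, h2, h3, h4, h5, fun i hi hk => not_not.1 (h6 i hi hk)⟩
  · left
    push Not at h
    by_cases hbad : ∃ r, (deg H r : ZMod p) ≠ 1
    · obtain ⟨r, hr⟩ := hbad
      exact star_of_one_bad hp H htree hH r (fun v hv => h r v hv.symm hr)
    · push Not at hbad
      obtain ⟨r⟩ := htree.connected.nonempty
      exact star_of_one_bad hp H htree hH r (fun v _ => hbad v)
end

section
/- Let H be a finite tree containing a path x_0 x_1 ... x_k with k ≥ 2. Then the number of walks of length k in H from x_1 to x_{k−1} equals (Σ_{i=1}^{k−1} deg_H(x_i)) − (k − 2). -/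
attribute [local instance] Classical.propDecidable

theorem walks_finite {V : Type*} [Fintype V] (H : SimpleGraph V) (n : ℕ) (u v : V) :
    Finite {w : H.Walk u v // w.length = n} := by
  classical
  exact Set.Finite.to_subtype (Set.toFinite {w : H.Walk u v | w.length = n})

noncomputable def walkStep {V : Type*} (H : SimpleGraph V) (n : ℕ) (u v : V) :
    (Σ w : {w : V // H.Adj u w}, {q : H.Walk w v // q.length = n}) ≃
      {w : H.Walk u v // w.length = n + 1} :=
  Equiv.ofBijective
    (fun a => ⟨SimpleGraph.Walk.cons a.1.2 a.2.1, by simp [a.2.2]⟩) (by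
      constructor
      · rintro ⟨⟨a, ha⟩, ⟨p, hp⟩⟩ ⟨⟨b, hb⟩, ⟨q, hq⟩⟩ h
        simp only [Subtype.mk.injEq, SimpleGraph.Walk.cons.injEq] at h
        obtain ⟨rfl, h⟩ := h
        obtain rfl := eq_of_heq h
        rfl
      · rintro ⟨p, hp⟩
        cases p with
        | nil => simp at hp
        | cons h q => exact ⟨⟨⟨_, h⟩, ⟨q, by simpa using hp⟩⟩, rfl⟩)

theorem card_walkStep {V : Type*} [Fintype V] (H : SimpleGraph V) (n : ℕ) (u v : V) :
    Nat.card {w : H.Walk u v // w.length = n + 1} =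
      ∑ w : {w : V // H.Adj u w}, Nat.card {q : H.Walk w v // q.length = n} := by
  have := fun w : {w : V // H.Adj u w} => walks_finite H n w v
  rw [← Nat.card_congr (walkStep H n u v), Nat.card_sigma]

theorem card_path {V : Type*} (H : SimpleGraph V) (hH : H.IsAcyclic) {u v : V}
    (p : H.Walk u v) (hp : p.IsPath) (n : ℕ) (hn : p.length = n) :
    Nat.card {w : H.Walk u v // w.length = n} = 1 := by
  classical
  rw [Nat.card_eq_one_iff_exists]
  refine ⟨⟨p, hn⟩, ?_⟩
  rintro ⟨q, hq⟩
  have h1 : q.bypass = p :=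
    congrArg Subtype.val (hH.path_unique ⟨q.bypass, q.bypass_isPath⟩ ⟨p, hp⟩)
  have h2 : q.bypass = q := SimpleGraph.Walk.bypass_eq_self_of_length_le_length_bypass q (by rw [h1]; omega)
  simp only [Subtype.mk.injEq]
  rw [← h2, h1]

theorem card_main {V : Type*} [Fintype V] (H : SimpleGraph V) (hH : H.IsAcyclic) {u v : V}
    (p : H.Walk u v) (hp : p.IsPath) :
    Nat.card {w : H.Walk u v // w.length = p.length + 2} + p.length
      = (p.support.map (deg H)).sum := by
  induction p with
  | nil =>
    rename_i u
    rw [SimpleGraph.Walk.length_nil, card_walkStep, Finset.sum_congr rfl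
      (fun w _ => card_path H hH (SimpleGraph.Walk.cons (w.2.symm) .nil) (by
        simpa using w.2.ne') 1 rfl)]
    simp only [Finset.sum_const, smul_eq_mul, mul_one, Finset.card_univ]
    have hd : deg H u = Fintype.card {w : V // H.Adj u w} := Nat.card_eq_fintype_card (α := {w : V // H.Adj u w})
    simp [hd]
  | @cons u s v h p ih =>
    rw [SimpleGraph.Walk.cons_isPath_iff] at hp
    have ih := ih hp.1
    rw [SimpleGraph.Walk.length_cons, card_walkStep,
      ← Finset.add_sum_erase _ _ (Finset.mem_univ (⟨s, h⟩ : {w : V // H.Adj u w}))]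
    rw [Finset.sum_congr rfl (g := fun _ => 1) (fun w hw => ?_)]
    · have hd : deg H u = Fintype.card ({w : V // H.Adj u w}) :=
        Nat.card_eq_fintype_card (α := {w : V // H.Adj u w})
      have : 0 < Fintype.card ({w : V // H.Adj u w}) := Fintype.card_pos_iff.2 ⟨⟨s, h⟩⟩
      simp only [SimpleGraph.Walk.support_cons, List.map_cons, List.sum_cons, Finset.sum_const,
        smul_eq_mul, mul_one, Finset.mem_univ, Finset.card_erase_of_mem, Finset.card_univ]
      rw [← ih, hd]
      have e : p.length + 1 + 1 = p.length + 2 := rfl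
      rw [e]
      omega
    · have hpu : (SimpleGraph.Walk.cons h p).IsPath := by
        rw [SimpleGraph.Walk.cons_isPath_iff]; exact hp
      refine card_path H hH (SimpleGraph.Walk.cons (w.2.symm) (.cons h p)) ?_ _ rfl
      rw [SimpleGraph.Walk.cons_isPath_iff]
      refine ⟨hpu, fun hmem => ?_⟩
      have h3 := hH.eq_snd_of_adj_start hpu w.2 hmem
      apply (Finset.mem_erase.1 hw).1
      exact Subtype.ext (by simpa using h3)

theorem exists_path_of_fun {V : Type*} (H : SimpleGraph V) (d : ℕ) : ∀ (y : ℕ → V),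
    (∀ i < d, H.Adj (y i) (y (i + 1))) → (∀ i ≤ d, ∀ j ≤ d, y i = y j → i = j) →
    ∃ p : H.Walk (y 0) (y d), p.IsPath ∧ p.length = d ∧
      p.support = (List.range (d + 1)).map y := by
  induction d with
  | zero => intro y _ _; exact ⟨.nil, by simp⟩
  | succ d ih =>
    intro y hy hi
    obtain ⟨p, h1, h2, h3⟩ := ih (fun i => y (i + 1)) (fun i h => hy _ (by omega))
      (fun i hi' j hj h => by have := hi _ (by omega) _ (by omega) h; omega)
    refine ⟨.cons (hy 0 (by omega)) p, ?_, by simp [h2], ?_⟩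
    · rw [SimpleGraph.Walk.cons_isPath_iff]
      refine ⟨h1, ?_⟩
      rw [h3]
      simp only [List.mem_map, List.mem_range, not_exists, not_and]
      intro a ha h
      have := hi _ (by omega) _ (by omega) h
      omega
    · rw [SimpleGraph.Walk.support_cons, h3, List.range_succ_eq_map (n := d + 1)]
      simp [Function.comp_def]

theorem stmt13 {V : Type*} [Fintype V] (H : SimpleGraph V) (htree : H.IsTree)
    (k : ℕ) (hk : 2 ≤ k) (x : Fin (k + 1) → V) (hinj : Function.Injective x)
    (hadj : ∀ i : Fin k, H.Adj (x i.castSucc) (x i.succ)) :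
    Nat.card {w : H.Walk (x ⟨1, by omega⟩) (x ⟨k - 1, by omega⟩) // w.length = k}
      = (∑ i ∈ Finset.univ.filter
            (fun i : Fin (k + 1) => 1 ≤ (i : ℕ) ∧ (i : ℕ) ≤ k - 1),
          deg H (x i)) - (k - 2) := by
  obtain ⟨m, rfl⟩ : ∃ m, k = m + 2 := ⟨k - 2, by omega⟩
  let y : ℕ → V := fun i => if h : i ≤ m then x ⟨i + 1, by omega⟩ else x 0
  have hy : ∀ i (h : i ≤ m), y i = x ⟨i + 1, by omega⟩ := fun i h => dif_pos h
  obtain ⟨p, h1, h2, h3⟩ := exists_path_of_fun H m y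
    (fun i h => by
      rw [hy i (by omega), hy (i + 1) (by omega)]
      exact hadj ⟨i + 1, by omega⟩)
    (fun i hi j hj h => by
      rw [hy i hi, hy j hj] at h
      have := hinj h
      simpa using this)
  have hc := card_main H htree.isAcyclic p h1
  rw [h3, h2] at hc
  have e0 : y 0 = x ⟨1, by omega⟩ := hy 0 (by omega)
  have em : y m = x ⟨m + 2 - 1, by omega⟩ := hy m le_rfl
  rw [e0, em] at hc
  have hs : ((List.map y (List.range (m + 1))).map (deg H)).sum =
      ∑ i ∈ Finset.univ.filter
            (fun i : Fin (m + 2 + 1) => 1 ≤ (i : ℕ) ∧ (i : ℕ) ≤ m + 2 - 1),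
          deg H (x i) := by
    rw [List.map_map]
    change ∑ i ∈ Finset.range (m + 1), deg H (y i) = _
    refine Finset.sum_bij' (fun i hi => ⟨i + 1, by have := Finset.mem_range.1 hi; omega⟩)
      (fun i _ => (i : ℕ) - 1) ?_ ?_ ?_ ?_ ?_
    · intro i hi; have := Finset.mem_range.1 hi; simp; omega
    · intro i hi; simp at hi ⊢; omega
    · intro i hi; simp
    · intro i hi; simp at hi; ext; simp; omega
    · intro i hi; have := Finset.mem_range.1 hi; rw [hy i (by omega)]
  rw [← hs, ← hc]
  omega
end

section
/- Let G=(V_L,V_R,E) be a finite connected bipartite graph, and let P_4 denote the path w_1 w_2 w_3 w_4 on four vertices. Then |Hom(G, P_4)| = 2 · |I(G)|, where Hom(G, P_4) is the set of all graph homomorphisms from G to P_4. -/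
attribute [local instance] Classical.propDecidable

/-- The vertex of the path with given parity and endpoint flag. -/
def colP (p e : Bool) : Fin 4 :=
  match p, e with
  | false, true => 0
  | false, false => 2
  | true, true => 3
  | true, false => 1

def parP (x : Fin 4) : Bool := x = 1 ∨ x = 3
def endP (x : Fin 4) : Bool := x = 0 ∨ x = 3

theorem par_col (p e : Bool) : parP (colP p e) = p := by
  cases p <;> cases e <;> simp [parP, colP]

theorem end_col (p e : Bool) : endP (colP p e) = e := by
  cases p <;> cases e <;> simp [endP, colP]

theorem col_par_end (x : Fin 4) : colP (parP x) (endP x) = x := by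
  fin_cases x <;> simp [parP, endP, colP]

theorem adj_iffP (x y : Fin 4) : (SimpleGraph.pathGraph 4).Adj x y ↔
    (parP x = !parP y) ∧ ¬ (endP x = true ∧ endP y = true) := by
  rw [SimpleGraph.pathGraph_adj]
  fin_cases x <;> fin_cases y <;> simp [parP, endP]

theorem stmt16 {V : Type*} [Fintype V] (G : SimpleGraph V) (L R : Finset V)
    (hpart : L ∪ R = Finset.univ) (hdisj : Disjoint L R)
    (hbip : ∀ u v, G.Adj u v → (u ∈ L ∧ v ∈ R) ∨ (u ∈ R ∧ v ∈ L))
    (hconn : G.Connected) :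
    Fintype.card {f : V → Fin 4 //
        ∀ a b, G.Adj a b → (SimpleGraph.pathGraph 4).Adj (f a) (f b)}
      = 2 * (indepSets G).card := by
  have hside : ∀ u v, G.Adj u v → decide (u ∈ L) = !decide (v ∈ L) := by
    intro u v huv
    have hd := Finset.disjoint_left.mp hdisj
    rcases hbip u v huv with ⟨h1, h2⟩ | ⟨h1, h2⟩
    · have : v ∉ L := fun h => hd h h2
      simp [h1, this]
    · have : u ∉ L := fun h => hd h h1
      simp [h2, this]
  obtain ⟨v0⟩ := hconn.nonempty
  have hI : ∀ I : Finset V, I ∈ indepSets G ↔ ∀ u ∈ I, ∀ v ∈ I, ¬ G.Adj u v := by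
    intro I
    simp [indepSets]
  let F : Bool × {I // I ∈ indepSets G} → {f : V → Fin 4 //
        ∀ a b, G.Adj a b → (SimpleGraph.pathGraph 4).Adj (f a) (f b)} := fun x =>
    ⟨fun v => colP (x.1 ^^ decide (v ∈ L)) (decide (v ∈ x.2.1)), by
      intro a b hab
      rw [adj_iffP, par_col, par_col, end_col, end_col, hside a b hab]
      refine ⟨by simp, ?_⟩
      rintro ⟨h1, h2⟩
      exact (hI _).1 x.2.2 a (by simpa using h1) b (by simpa using h2) hab⟩
  have hF : Function.Bijective F := by
    constructor
    · rintro ⟨p, I, hp⟩ ⟨q, J, hq⟩ h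
      have h' : ∀ v, colP (p ^^ decide (v ∈ L)) (decide (v ∈ I))
          = colP (q ^^ decide (v ∈ L)) (decide (v ∈ J)) := fun v =>
        congrFun (congrArg Subtype.val h) v
      have e1 : p = q := by
        have := congrArg parP (h' v0)
        rw [par_col, par_col] at this
        simpa using this
      have e2 : I = J := by
        ext v
        have := congrArg endP (h' v)
        rw [end_col, end_col] at this
        simpa using this
      subst e1 e2
      rfl
    · rintro ⟨f, hf⟩
      have hstep : ∀ u v, G.Adj u v →
          (parP (f u) ^^ decide (u ∈ L)) = (parP (f v) ^^ decide (v ∈ L)) := by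
        intro u v huv
        rw [((adj_iffP _ _).1 (hf u v huv)).1, hside u v huv]
        simp
      have hconst : ∀ v, (parP (f v) ^^ decide (v ∈ L))
          = (parP (f v0) ^^ decide (v0 ∈ L)) := by
        intro v
        obtain ⟨w⟩ := hconn.preconnected v v0
        induction w with
        | nil => rfl
        | cons h _ ih => exact (hstep _ _ h).trans ih
      refine ⟨(parP (f v0) ^^ decide (v0 ∈ L),
        ⟨Finset.univ.filter (fun v => endP (f v) = true), ?_⟩), ?_⟩
      · rw [hI]
        intro u hu v hv huv
        simp only [Finset.mem_filter, Finset.mem_univ, true_and] at hu hv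
        exact ((adj_iffP _ _).1 (hf u v huv)).2 ⟨hu, hv⟩
      · apply Subtype.ext
        funext v
        change colP _ _ = f v
        rw [← col_par_end (f v), ← hconst v]
        simp
  have hc := Fintype.card_of_bijective hF
  rw [Fintype.card_prod, Fintype.card_bool, Fintype.card_coe] at hc
  convert hc.symm
end
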